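/- arXiv:2505.13370 — 4 statements merged into one kernel-verified Lean document; each statement's English description precedes it below -/
import Mathlib

section
/- Kolmogorov's superposition theorem: For every natural number d ≥ 1 and every continuous function f : [0,1]^d → ℝ, there exist continuous one-dimensional functions Φ¹_{i,j} : [0,1] → ℝ (for i = 1, …, 2d+1 and j = 1, …, d) and continuous one-dimensional functions Φ²_i : ℝ → ℝ (for i = 1, …, 2d+1) such that for every x = (x₁, …, x_d) ∈ [0,1]^d, f(x) = Σ_{i=1}^{2d+1} Φ²_i ( Σ_{j=1}^{d} Φ¹_{i,j}(x_j) ). -/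
open scoped BoundedContinuousFunction
open Topology

namespace KolmogorovSuperposition

/-! ### A continuous staircase -/

/-- A continuous nondecreasing function which agrees with the floor except on the last `1 / L` of
every unit interval. -/
noncomputable def stair (L t : ℝ) : ℝ :=
  ⌊t⌋ + max 0 (L * Int.fract t - (L - 1))

lemma continuous_stair {L : ℝ} (hL : 1 ≤ L) : Continuous (stair L) := by
  have h : Continuous ((fun s : ℝ => max 0 (L * s - (L - 1)) - s) ∘ Int.fract) := by
    apply ContinuousOn.comp_fract''
    · fun_prop
    · simp [hL]
  have h2 : stair L = fun t => t + ((fun s : ℝ => max 0 (L * s - (L - 1)) - s) ∘ Int.fract) t := by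
    funext t
    have := Int.floor_add_fract t
    simp only [stair, Function.comp]
    linarith
  rw [h2]
  exact continuous_id.add h

lemma abs_stair_sub_le {L : ℝ} (hL : 1 ≤ L) (t : ℝ) : |stair L t - t| ≤ 1 := by
  have h0 := Int.fract_nonneg t
  have h1 := Int.fract_lt_one t
  have h2 := Int.floor_add_fract t
  have h3 : max 0 (L * Int.fract t - (L - 1)) ≤ 1 := max_le zero_le_one (by nlinarith)
  have h4 : 0 ≤ max 0 (L * Int.fract t - (L - 1)) := le_max_left _ _
  unfold stair
  rw [abs_le]
  constructor <;> linarith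

lemma stair_eq_floor {L t : ℝ} (h : L * Int.fract t ≤ L - 1) : stair L t = ⌊t⌋ := by
  unfold stair
  rw [max_eq_left (by linarith), add_zero]

/-! ### Elementary counting and genericity facts -/

/-- Among the shifts of a real number by multiples of `1 / n`, at most one falls in the last `1 / n`
of a unit interval. -/
lemma eq_of_fract_add_div {n : ℕ} {t : ℝ} {i i' : Fin n}
    (h : (n : ℝ) - 1 < n * Int.fract (t + i / n)) (h' : (n : ℝ) - 1 < n * Int.fract (t + i' / n)) :
    i = i' := by
  have hn : (0 : ℝ) < n := by exact_mod_cast i.pos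
  have e := Int.floor_add_fract (t + i / n)
  have e' := Int.floor_add_fract (t + i' / n)
  have l := Int.fract_lt_one (t + i / n)
  have l' := Int.fract_lt_one (t + i' / n)
  set a := Int.fract (t + i / n)
  set b := Int.fract (t + i' / n)
  set u := ⌊t + (i : ℝ) / n⌋
  set v := ⌊t + (i' : ℝ) / n⌋
  have hi : (n : ℝ) * (i / n) = i := by field_simp
  have hi' : (n : ℝ) * (i' / n) = i' := by field_simp
  have key : (i : ℝ) - i' - n * (u - v) = n * a - n * b := by
    have : (n : ℝ) * (i / n) - n * (i' / n) = n * (u + a) - n * (v + b) := by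
      rw [e, e']; ring
    rw [hi, hi'] at this
    linarith
  have la : n * a < n := by nlinarith
  have lb : n * b < n := by nlinarith
  have k1 : (((i : ℤ) - i' - n * (u - v) : ℤ) : ℝ) < 1 := by push_cast; linarith
  have k2 : (-1 : ℝ) < (((i : ℤ) - i' - n * (u - v) : ℤ) : ℝ) := by push_cast; linarith
  have k1' : (i : ℤ) - i' - n * (u - v) < 1 := by exact_mod_cast k1
  have k2' : -1 < (i : ℤ) - i' - n * (u - v) := by exact_mod_cast k2
  have k3 : (i : ℤ) - i' = n * (u - v) := by omega
  have k4 : (i : ℤ) - i' = 0 := by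
    apply Int.eq_zero_of_abs_lt_dvd (m := n) ⟨_, k3⟩
    have := i.2
    have := i'.2
    rw [abs_lt]
    omega
  ext
  omega

open Classical in
lemma card_filter_fract_le {n d : ℕ} (t : Fin d → ℝ) :
    (Finset.univ.filter fun i : Fin n =>
      ∃ j, (n : ℝ) - 1 < n * Int.fract (t j + i / n)).card ≤ d := by
  have h : ∀ i : Fin n, ∃ j : Option (Fin d), ∀ _ : ∃ j, (n : ℝ) - 1 < n * Int.fract (t j + i / n),
      ∃ j', j = some j' ∧ (n : ℝ) - 1 < n * Int.fract (t j' + i / n) := by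
    intro i
    by_cases h : ∃ j, (n : ℝ) - 1 < n * Int.fract (t j + i / n)
    · obtain ⟨j, hj⟩ := h
      exact ⟨some j, fun _ => ⟨j, rfl, hj⟩⟩
    · exact ⟨none, fun h' => absurd h' h⟩
  choose J hJ using h
  have := Finset.card_le_card_of_injOn (t := Finset.univ.map Function.Embedding.some)
    (s := Finset.univ.filter fun i : Fin n => ∃ j, (n : ℝ) - 1 < n * Int.fract (t j + i / n)) J
    (by
      intro i hi
      obtain ⟨j, hj, -⟩ := hJ i (by simpa using hi)
      simp [hj])
    (by
      intro i hi i' hi' e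
      obtain ⟨j, hj, h⟩ := hJ i (by simpa using hi)
      obtain ⟨j', hj', h'⟩ := hJ i' (by simpa using hi')
      rw [hj, hj', Option.some_inj] at e
      subst e
      exact eq_of_fract_add_div h h')
  simpa using this

lemma finite_setOf_not_injective_add_mul {K : Type*} [Finite K] (A : K → ℝ) {B : K → ℝ}
    (hB : Function.Injective B) :
    {η : ℝ | ¬ Function.Injective fun k => A k + η * B k}.Finite := by
  apply (Set.finite_range fun p : K × K => (A p.1 - A p.2) / (B p.2 - B p.1)).subset
  intro η hη
  simp only [Function.Injective, Set.mem_ofPred_eq, not_forall] at hη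
  obtain ⟨k, k', h, hne⟩ := hη
  refine ⟨(k, k'), ?_⟩
  have : B k' - B k ≠ 0 := sub_ne_zero.2 fun h => hne (hB h).symm
  simp only
  rw [div_eq_iff this]
  linarith

lemma abs_sub_sum_le {d : ℕ} {F m δ : ℝ} {a : Fin (2 * d + 1) → ℝ} {B : Finset (Fin (2 * d + 1))}
    (hB : B.card ≤ d) (hF : |F| ≤ m) (ha : ∀ i, |a i| ≤ m / (d + 1)) (hδ : 0 ≤ δ)
    (hgood : ∀ i ∉ B, |F / (d + 1) - a i| ≤ δ) :
    |F - ∑ i, a i| ≤ d * (m / (d + 1)) + (2 * d + 1) * δ := by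
  classical
  have hd : (0 : ℝ) < d + 1 := by positivity
  have hcard : (B.card : ℝ) + (Bᶜ.card : ℝ) = 2 * d + 1 := by
    have := Finset.card_add_card_compl B
    rw [Fintype.card_fin] at this
    exact_mod_cast this
  have hB' : (B.card : ℝ) ≤ d := by exact_mod_cast hB
  have h1 : |∑ i ∈ Bᶜ, (F / (d + 1) - a i)| ≤ Bᶜ.card * δ := by
    rw [← nsmul_eq_mul]
    exact (Finset.abs_sum_le_sum_abs _ _).trans
      (Finset.sum_le_card_nsmul _ _ _ fun i hi => hgood i (by simpa using hi))
  have h2 : |∑ i ∈ B, a i| ≤ B.card * (m / (d + 1)) := by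
    rw [← nsmul_eq_mul]
    exact (Finset.abs_sum_le_sum_abs _ _).trans (Finset.sum_le_card_nsmul _ _ _ fun i _ => ha i)
  have h3 : ∑ i, a i = ∑ i ∈ B, a i + ∑ i ∈ Bᶜ, a i := (Finset.sum_add_sum_compl B a).symm
  have h4 : F - ∑ i, a i =
      (d - Bᶜ.card + 1) * (F / (d + 1)) + ∑ i ∈ Bᶜ, (F / (d + 1) - a i) - ∑ i ∈ B, a i := by
    rw [h3, Finset.sum_sub_distrib, Finset.sum_const, nsmul_eq_mul]
    field_simp
    ring
  have h5 : |(d - Bᶜ.card + 1) * (F / (d + 1))| ≤ (d - B.card) * (m / (d + 1)) := by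
    rw [abs_mul, abs_div, abs_of_pos hd]
    have : |(d : ℝ) - Bᶜ.card + 1| = d - B.card := by
      rw [abs_of_nonpos (by linarith)]
      linarith
    rw [this]
    gcongr
  have h6 : Bᶜ.card * δ ≤ (2 * d + 1) * δ := by
    gcongr
    have : (0 : ℝ) ≤ B.card := by positivity
    linarith
  rw [h4]
  refine (abs_sub _ _).trans ?_
  have := abs_add_le ((d - Bᶜ.card + 1) * (F / (d + 1))) (∑ i ∈ Bᶜ, (F / (d + 1) - a i))
  linarith

/-! ### The superposition operator -/

/-- The sum of univariate functions `x ↦ ∑ j, φ j (x j)` on the unit cube. -/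
noncomputable def innerSum {d : ℕ} (φ : Fin d → C(Set.Icc (0 : ℝ) 1, ℝ)) :
    C(Fin d → Set.Icc (0 : ℝ) 1, ℝ) :=
  ⟨fun x => ∑ j, φ j (x j), by fun_prop⟩

lemma continuous_innerSum (d : ℕ) :
    Continuous (innerSum : (Fin d → C(Set.Icc (0 : ℝ) 1, ℝ)) → _) := by
  have h : (innerSum : (Fin d → C(Set.Icc (0 : ℝ) 1, ℝ)) → _) =
      fun φ => ∑ j, (φ j).comp ⟨fun x => x j, continuous_apply j⟩ := by
    funext φ
    ext x
    simp [innerSum]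
  rw [h]
  exact continuous_finsetSum _ fun j _ =>
    (ContinuousMap.continuous_precomp _).comp (continuous_apply j)

/-- For fixed inner functions, the superposition depends linearly and continuously on the outer
functions. -/
noncomputable def superpose {n d : ℕ} (φ : Fin n → Fin d → C(Set.Icc (0 : ℝ) 1, ℝ)) :
    (Fin n → ℝ →ᵇ ℝ) →L[ℝ] C(Fin d → Set.Icc (0 : ℝ) 1, ℝ) :=
  LinearMap.mkContinuous
    { toFun := fun g => ∑ i, (g i).toContinuousMap.comp (innerSum (φ i))
      map_add' := fun g g' => by
        ext x
        simp [Finset.sum_add_distrib]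
      map_smul' := fun c g => by
        ext x
        simp [Finset.mul_sum] }
    n fun g => by
      rw [ContinuousMap.norm_le _ (by positivity)]
      intro x
      simp only [LinearMap.coe_mk, AddHom.coe_mk, ContinuousMap.sum_apply]
      refine (norm_sum_le _ _).trans ?_
      refine (Finset.sum_le_card_nsmul _ _ ‖g‖ fun i _ => ?_).trans (by simp)
      exact ((g i).norm_coe_le_norm _).trans (norm_le_pi_norm g i)

lemma superpose_apply {n d : ℕ} (φ : Fin n → Fin d → C(Set.Icc (0 : ℝ) 1, ℝ))
    (g : Fin n → ℝ →ᵇ ℝ) (x : Fin d → Set.Icc (0 : ℝ) 1) :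
    superpose φ g x = ∑ i, g i (∑ j, φ i j (x j)) := by
  simp [superpose, innerSum]

lemma continuous_superpose_apply {n d : ℕ} (g : Fin n → ℝ →ᵇ ℝ) :
    Continuous fun φ : Fin n → Fin d → C(Set.Icc (0 : ℝ) 1, ℝ) => superpose φ g := by
  change Continuous fun φ : Fin n → Fin d → C(Set.Icc (0 : ℝ) 1, ℝ) =>
    ∑ i, (g i).toContinuousMap.comp (innerSum (φ i))
  exact continuous_finsetSum _ fun i _ => (ContinuousMap.continuous_postcomp _).comp
    ((continuous_innerSum d).comp (continuous_apply i))

/-- A bounded operator which approximately solves every equation with a fixed relative error less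
than one is surjective. -/
lemma surjective_of_approx {E F : Type*} [NormedAddCommGroup E] [NormedSpace ℝ E] [CompleteSpace E]
    [NormedAddCommGroup F] [NormedSpace ℝ F] (T : E →L[ℝ] F) {C θ : ℝ} (hθ0 : 0 ≤ θ) (hθ : θ < 1)
    (h : ∀ y, ∃ x, ‖x‖ ≤ C * ‖y‖ ∧ ‖y - T x‖ ≤ θ * ‖y‖) : Function.Surjective T := by
  choose G hG hT using h
  intro y
  let r : ℕ → F := fun n => (fun z => z - T (G z))^[n] y
  have hr : ∀ n, r (n + 1) = r n - T (G (r n)) := fun n => Function.iterate_succ_apply' _ _ _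
  have hrn : ∀ n, ‖r n‖ ≤ θ ^ n * ‖y‖ := by
    intro n
    induction n with
    | zero => simp [r]
    | succ n ih =>
      rw [hr, pow_succ', mul_assoc]
      exact (hT _).trans (by gcongr)
  have hr0 : Filter.Tendsto r Filter.atTop (𝓝 0) := by
    apply squeeze_zero_norm hrn
    simpa using (tendsto_pow_atTop_nhds_zero_of_lt_one hθ0 hθ).mul_const ‖y‖
  have hs : Summable fun n => G (r n) := by
    refine Summable.of_norm_bounded (g := fun n => |C| * (θ ^ n * ‖y‖))
      (((summable_geometric_of_lt_one hθ0 hθ).mul_right _).mul_left _) fun n => ?_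
    refine (hG _).trans ?_
    exact (mul_le_mul_of_nonneg_right (le_abs_self C) (norm_nonneg _)).trans
      (mul_le_mul_of_nonneg_left (hrn n) (abs_nonneg C))
  refine ⟨∑' n, G (r n), ?_⟩
  have h1 := (hs.hasSum.mapL T).tendsto_sum_nat
  have h2 : ∀ n, ∑ i ∈ Finset.range n, T (G (r i)) = y - r n := by
    intro n
    induction n with
    | zero => simp [r]
    | succ n ih => rw [Finset.sum_range_succ, ih, hr]; abel
  simp only [h2] at h1
  have h3 := (tendsto_const_nhds (x := y)).sub hr0
  rw [sub_zero] at h3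
  exact tendsto_nhds_unique h1 h3

/-! ### Genericity of good inner functions -/

/-- The inner functions which allow `f` to be approximated with relative error less than `θ` by
a superposition with outer functions of norm at most `‖f‖`. -/
def goodInner (d : ℕ) (θ : ℝ) (f : C(Fin d → Set.Icc (0 : ℝ) 1, ℝ)) :
    Set (Fin (2 * d + 1) → Fin d → C(Set.Icc (0 : ℝ) 1, ℝ)) :=
  {φ | ∃ g : Fin (2 * d + 1) → ℝ →ᵇ ℝ, ‖g‖ ≤ ‖f‖ ∧ ‖f - superpose φ g‖ < θ * ‖f‖}

lemma isOpen_goodInner (d : ℕ) (θ : ℝ) (f : C(Fin d → Set.Icc (0 : ℝ) 1, ℝ)) :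
    IsOpen (goodInner d θ f) := by
  have : goodInner d θ f = ⋃ g : {g : Fin (2 * d + 1) → ℝ →ᵇ ℝ // ‖g‖ ≤ ‖f‖},
      {φ | ‖f - superpose φ g‖ < θ * ‖f‖} := by
    ext φ
    simp [goodInner]
  rw [this]
  exact isOpen_iUnion fun g => isOpen_lt
    (continuous_const.sub (continuous_superpose_apply _)).norm continuous_const

lemma exists_outer_of_injective {K : Type*} [Finite K] {s v : K → ℝ} {m : ℝ} (hm : 0 ≤ m)
    (hs : Function.Injective s) (hv : ∀ k, |v k| ≤ m) :
    ∃ g : ℝ →ᵇ ℝ, ‖g‖ ≤ m ∧ ∀ k, g (s k) = v k := by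
  let _ : TopologicalSpace K := ⊥
  have : DiscreteTopology K := ⟨rfl⟩
  have he : IsClosedEmbedding s := continuous_of_discreteTopology.isClosedEmbedding hs
  obtain ⟨g, hg, hgs⟩ := BoundedContinuousFunction.exists_extension_norm_eq_of_isClosedEmbedding
    (BoundedContinuousFunction.mkOfCompact ⟨v, continuous_of_discreteTopology⟩) he
  refine ⟨g, ?_, fun k => congrFun hgs k⟩
  rw [hg, BoundedContinuousFunction.norm_le hm]
  exact hv

/-- Rounding of the unit interval to the grid `ℤ / N`, exact away from small gaps whose position
depends on the shift `s`. -/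
noncomputable def roundTo (L : ℝ) (N : ℕ) (s : ℝ) (x : Set.Icc (0 : ℝ) 1) : Set.Icc (0 : ℝ) 1 :=
  Set.projIcc 0 1 zero_le_one (stair L (N * x + s) / N)

lemma dist_roundTo_le {L s : ℝ} {N : ℕ} (hL : 1 ≤ L) (hN : 0 < N) (hs0 : 0 ≤ s) (hs1 : s < 1)
    (x : Set.Icc (0 : ℝ) 1) : dist (roundTo L N s x) x ≤ 2 / N := by
  have hN' : (0 : ℝ) < N := by exact_mod_cast hN
  have h1 : dist (roundTo L N s x) x ≤ |stair L (N * x + s) / N - x| := by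
    rw [Subtype.dist_eq, Real.dist_eq, roundTo]
    have h2 := Set.abs_projIcc_sub_projIcc (zero_le_one (α := ℝ))
      (c := stair L (N * x + s) / N) (d := x)
    rwa [Set.projIcc_val] at h2
  refine h1.trans ?_
  have h2 : stair L (N * x + s) / N - x = (stair L (N * x + s) - (N * x + s) + s) / N := by
    field_simp
    ring
  rw [h2, abs_div, abs_of_pos hN']
  gcongr
  refine (abs_add_le _ _).trans ?_
  have := abs_stair_sub_le hL (N * x + s)
  rw [abs_of_nonneg hs0]
  linarith

lemma continuous_stair_affine {L : ℝ} (hL : 1 ≤ L) (N : ℕ) (s : ℝ) :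
    Continuous fun x : Set.Icc (0 : ℝ) 1 => stair L (N * x + s) :=
  (continuous_stair hL).comp (by fun_prop)

lemma continuous_roundTo {L : ℝ} (hL : 1 ≤ L) (N : ℕ) (s : ℝ) : Continuous (roundTo L N s) :=
  continuous_projIcc.comp ((continuous_stair_affine hL N s).div_const _)

lemma abs_stair_affine_le {L s : ℝ} {N : ℕ} (hL : 1 ≤ L) (hs0 : 0 ≤ s) (hs1 : s < 1)
    (x : Set.Icc (0 : ℝ) 1) : |stair L (N * x + s)| ≤ N + 2 := by
  have h := abs_le.1 (abs_stair_sub_le hL (N * x + s))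
  have h0 : (0 : ℝ) ≤ N * x := mul_nonneg (by positivity) x.2.1
  have h1 : (N : ℝ) * x ≤ N := mul_le_of_le_one_right (by positivity) x.2.2
  rw [abs_le]
  constructor <;> linarith [h.1, h.2, (Nat.cast_nonneg N : (0 : ℝ) ≤ N)]

lemma exists_stair_affine_eq {L s : ℝ} {N : ℕ} (hs0 : 0 ≤ s) (hs1 : s < 1)
    (x : Set.Icc (0 : ℝ) 1) (h : L * Int.fract (N * (x : ℝ) + s) ≤ L - 1) :
    ∃ k : Fin (N + 1), stair L (N * x + s) = k := by
  have h0 : (0 : ℝ) ≤ N * x := mul_nonneg (by positivity) x.2.1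
  have h1 : (N : ℝ) * x ≤ N := mul_le_of_le_one_right (by positivity) x.2.2
  have hf : 0 ≤ ⌊N * (x : ℝ) + s⌋ := Int.floor_nonneg.2 (by linarith)
  have hf' : ⌊N * (x : ℝ) + s⌋ < N + 1 := Int.floor_lt.2 (by push_cast; linarith)
  refine ⟨⟨⌊N * (x : ℝ) + s⌋.toNat, by omega⟩, ?_⟩
  rw [stair_eq_floor h]
  simp only
  exact_mod_cast (Int.toNat_of_nonneg hf).symm

lemma injective_sum_mul_pow (d N : ℕ) :
    Function.Injective fun k : Fin d → Fin (N + 1) =>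
      ∑ j : Fin d, ((N : ℝ) + 1) ^ (j : ℕ) * (k j : ℝ) := by
  intro k k' h
  apply finFunctionFinEquiv.injective
  ext
  rw [finFunctionFinEquiv_apply, finFunctionFinEquiv_apply]
  have : ((∑ j, (k j : ℕ) * (N + 1) ^ (j : ℕ) : ℕ) : ℝ) =
      (∑ j, (k' j : ℕ) * (N + 1) ^ (j : ℕ) : ℕ) := by
    push_cast
    simpa [mul_comm] using h
  exact_mod_cast this

lemma dense_goodInner (d : ℕ) {f : C(Fin d → Set.Icc (0 : ℝ) 1, ℝ)} (hf : f ≠ 0) :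
    Dense (goodInner d ((2 * d + 1) / (2 * (d + 1))) f) := by
  have hm : 0 < ‖f‖ := norm_pos_iff.2 hf
  set m := ‖f‖ with hm_def
  set δ : ℝ := m / (4 * (d + 1) * (2 * d + 1)) with hδ_def
  have hδ : 0 < δ := by positivity
  rw [Metric.dense_iff]
  intro φ ε hε
  obtain ⟨r₁, hr₁, hf₁⟩ := Metric.uniformContinuous_iff.1
    (CompactSpace.uniformContinuous_of_continuous f.continuous) δ hδ
  obtain ⟨r₂, hr₂, hφ₂⟩ := Metric.uniformContinuous_iff.1
    (CompactSpace.uniformContinuous_of_continuous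
      (f := fun (x : Set.Icc (0 : ℝ) 1) i j => φ i j x) (by fun_prop)) (ε / 2) (half_pos hε)
  have hφ : ∀ i j {x y : Set.Icc (0 : ℝ) 1}, dist x y < r₂ → dist (φ i j x) (φ i j y) < ε / 2 := by
    intro i j x y h
    have := hφ₂ h
    rw [dist_pi_lt_iff (half_pos hε)] at this
    have := this i
    rw [dist_pi_lt_iff (half_pos hε)] at this
    exact this j
  obtain ⟨N, hN⟩ := exists_nat_gt (2 / min r₁ r₂)
  have hmin : 0 < min r₁ r₂ := lt_min hr₁ hr₂
  have hN0 : (0 : ℝ) < N := lt_trans (by positivity) hN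
  have hNpos : 0 < N := by exact_mod_cast hN0
  have hNr : 2 / (N : ℝ) < min r₁ r₂ := by
    rw [div_lt_iff₀ hmin] at hN
    rw [div_lt_iff₀ hN0]
    linarith
  obtain ⟨L, hL_def⟩ : ∃ L : ℝ, L = 2 * d + 1 := ⟨_, rfl⟩
  have hL : 1 ≤ L := by
    have : (0 : ℝ) ≤ d := by positivity
    linarith
  have hcast : ((2 * d + 1 : ℕ) : ℝ) = L := by push_cast; exact hL_def.symm
  have hs0 : ∀ i : Fin (2 * d + 1), (0 : ℝ) ≤ i / L := fun i => by positivity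
  have hs1 : ∀ i : Fin (2 * d + 1), (i : ℝ) / L < 1 := fun i => by
    rw [div_lt_one (by linarith), ← hcast]
    exact_mod_cast i.2
  let p : Fin (N + 1) → Set.Icc (0 : ℝ) 1 := fun k => Set.projIcc 0 1 zero_le_one (k / N)
  have hbad : (⋃ i : Fin (2 * d + 1), {η : ℝ | ¬ Function.Injective fun k : Fin d → Fin (N + 1) =>
      (∑ j, φ i j (p (k j))) + η * ∑ j : Fin d, ((N : ℝ) + 1) ^ (j : ℕ) * (k j : ℝ)}).Finite :=
    Set.finite_iUnion fun i => finite_setOf_not_injective_add_mul _ (injective_sum_mul_pow d N)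
  set C : ℝ := ((N : ℝ) + 1) ^ d * (N + 2) with hC_def
  have hC : 0 < C := by positivity
  obtain ⟨η, ⟨hη0, hη1⟩, hη⟩ :=
    (Set.Ioo_infinite (show 0 < ε / 2 / C by positivity)).exists_notMem_finite hbad
  simp only [Set.mem_iUnion, Set.mem_ofPred_eq, not_exists, not_not] at hη
  let ψ : Fin (2 * d + 1) → Fin d → C(Set.Icc (0 : ℝ) 1, ℝ) := fun i j =>
    ⟨fun x => φ i j (roundTo L N (i / L) x) +
      η * (((N : ℝ) + 1) ^ (j : ℕ) * stair L (N * x + i / L)),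
      ((φ i j).continuous.comp (continuous_roundTo hL N _)).add
        (continuous_const.mul (continuous_const.mul (continuous_stair_affine hL N _)))⟩
  have hψ : dist ψ φ < ε := by
    rw [dist_pi_lt_iff hε]
    intro i
    rw [dist_pi_lt_iff hε]
    intro j
    rw [ContinuousMap.dist_lt_iff hε]
    intro x
    have h1 := hφ i j (((dist_roundTo_le hL hNpos (hs0 i) (hs1 i) x).trans_lt hNr).trans_le
      (min_le_right _ _))
    have h2 : |η * (((N : ℝ) + 1) ^ (j : ℕ) * stair L (N * x + i / L))| < ε / 2 := by
      rw [abs_mul, abs_mul, abs_of_pos hη0, abs_of_pos (by positivity)]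
      rw [lt_div_iff₀ hC] at hη1
      refine lt_of_le_of_lt ?_ hη1
      rw [hC_def]
      gcongr
      · linarith
      · exact j.2.le
      · exact abs_stair_affine_le hL (hs0 i) (hs1 i) x
    rw [Real.dist_eq] at h1 ⊢
    have h3 : ψ i j x - φ i j x = (φ i j (roundTo L N (i / L) x) - φ i j x) +
        η * (((N : ℝ) + 1) ^ (j : ℕ) * stair L (N * x + i / L)) := by
      simp only [ψ, ContinuousMap.coe_mk]
      ring
    rw [h3]
    exact (abs_add_le _ _).trans_lt (by linarith)
  have hd1 : (0 : ℝ) < d + 1 := by positivity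
  have hfm : ∀ x, |f x| ≤ m := f.norm_coe_le_norm
  have hg := fun i => exists_outer_of_injective (m := m / (d + 1)) (by positivity) (hη i)
    (v := fun k => f (fun j => p (k j)) / (d + 1)) (fun k => by
      rw [abs_div, abs_of_pos hd1]
      gcongr
      exact hfm _)
  choose g hgn hg using hg
  refine ⟨ψ, hψ, g, ?_, ?_⟩
  · rw [pi_norm_le_iff_of_nonneg hm.le]
    intro i
    refine (hgn i).trans (div_le_self hm.le ?_)
    have : (0 : ℝ) ≤ d := by positivity
    linarith
  · have hlt : d * (m / (d + 1)) + (2 * d + 1) * δ < (2 * d + 1) / (2 * (d + 1)) * m := by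
      have e : (2 * (d : ℝ) + 1) / (2 * (d + 1)) * m - (d * (m / (d + 1)) + (2 * d + 1) * δ) =
          m / (4 * (d + 1)) := by
        rw [hδ_def]
        field_simp
        ring
      have : 0 < m / (4 * ((d : ℝ) + 1)) := by positivity
      linarith
    refine lt_of_le_of_lt ?_ hlt
    rw [ContinuousMap.norm_le _ (by positivity)]
    intro x
    rw [ContinuousMap.sub_apply, superpose_apply, Real.norm_eq_abs]
    classical
    refine abs_sub_sum_le (card_filter_fract_le (n := 2 * d + 1) fun j => N * (x j : ℝ)) (hfm x)
      (fun i => ((g i).norm_coe_le_norm _).trans (hgn i)) hδ.le ?_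
    intro i hi
    simp only [Finset.mem_filter, Finset.mem_univ, true_and, not_exists, not_lt, hcast] at hi
    choose k hk using fun j => exists_stair_affine_eq (hs0 i) (hs1 i) (x j) (hi j)
    have hround : ∀ j, roundTo L N (i / L) (x j) = p (k j) := fun j => by
      simp only [roundTo, p, hk]
    have hsum : ∑ j, ψ i j (x j) = (∑ j, φ i j (p (k j))) +
        η * ∑ j : Fin d, ((N : ℝ) + 1) ^ (j : ℕ) * (k j : ℝ) := by
      simp only [ψ, ContinuousMap.coe_mk, hround, hk, Finset.sum_add_distrib, Finset.mul_sum]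
    rw [hsum, hg, ← sub_div, abs_div, abs_of_pos hd1]
    refine (div_le_self (abs_nonneg _) (by linarith [(Nat.cast_nonneg d : (0 : ℝ) ≤ d)])).trans ?_
    rw [← Real.dist_eq]
    refine (hf₁ ?_).le
    rw [dist_pi_lt_iff hr₁]
    intro j
    rw [← hround, dist_comm]
    exact ((dist_roundTo_le hL hNpos (hs0 i) (hs1 i) (x j)).trans_lt hNr).trans_le (min_le_left _ _)

/-- There are inner functions, independent of the target, for which every continuous function on
the cube is a superposition. -/
lemma exists_surjective_superpose (d : ℕ) :
    ∃ φ : Fin (2 * d + 1) → Fin d → C(Set.Icc (0 : ℝ) 1, ℝ), Function.Surjective (superpose φ) := by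
  set θ : ℝ := (2 * d + 1) / (2 * (d + 1)) with hθ_def
  have hθ0 : 0 < θ := by positivity
  have hθ1 : θ < 1 := by
    rw [hθ_def, div_lt_one (by positivity)]
    linarith
  obtain ⟨D, hDc, hD⟩ :=
    TopologicalSpace.exists_countable_dense C(Fin d → Set.Icc (0 : ℝ) 1, ℝ)
  have : Countable {f : D // (f : C(Fin d → Set.Icc (0 : ℝ) 1, ℝ)) ≠ 0} :=
    have := hDc.to_subtype
    inferInstance
  have : BaireSpace (Fin (2 * d + 1) → Fin d → C(Set.Icc (0 : ℝ) 1, ℝ)) :=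
    BaireSpace.of_completelyPseudoMetrizable
  have hdense := dense_iInter_of_isOpen
    (f := fun f : {f : D // (f : C(Fin d → Set.Icc (0 : ℝ) 1, ℝ)) ≠ 0} => goodInner d θ f)
    (fun f => isOpen_goodInner d θ f) (fun f => dense_goodInner d f.2)
  obtain ⟨φ, hφ⟩ := hdense.nonempty
  rw [Set.mem_iInter] at hφ
  refine ⟨φ, surjective_of_approx _ (C := 2) (θ := (1 + θ) / 2) (by linarith) (by linarith) ?_⟩
  intro f
  by_cases hf : f = 0
  · exact ⟨0, by simp [hf]⟩
  have hfn : 0 < ‖f‖ := norm_pos_iff.2 hf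
  set ε : ℝ := (1 - θ) / 4 with hε_def
  have hε : 0 < ε := by linarith
  obtain ⟨f', hf', hf'D⟩ := Metric.dense_iff.1 hD f (ε * ‖f‖) (by positivity)
  rw [Metric.mem_ball, dist_comm, dist_eq_norm] at hf'
  have hle : ‖f'‖ ≤ (1 + ε) * ‖f‖ := by
    have := norm_sub_norm_le f' f
    rw [norm_sub_rev] at this
    linarith
  have hf'0 : f' ≠ 0 := by
    rintro rfl
    rw [sub_zero] at hf'
    nlinarith
  obtain ⟨g, hg, hfg⟩ := hφ ⟨⟨f', hf'D⟩, hf'0⟩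
  refine ⟨g, hg.trans (hle.trans ?_), ?_⟩
  · gcongr
    linarith
  · have h1 := norm_add_le (f - f') (f' - superpose φ g)
    rw [sub_add_sub_cancel] at h1
    have h2 : θ * ‖f'‖ ≤ θ * ((1 + ε) * ‖f‖) := by gcongr
    have h3 : θ * (ε * ‖f‖) ≤ ε * ‖f‖ := mul_le_of_le_one_left (by positivity) hθ1.le
    have h4 : ε * ‖f‖ = (1 - θ) / 4 * ‖f‖ := rfl
    simp only at hfg
    linarith

end KolmogorovSuperposition

/-- Kolmogorov's superposition theorem: every continuous function on the unit cube
`[0,1]^d` can be written exactly as a sum of `2d+1` outer univariate continuous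
functions applied to sums of inner univariate continuous functions. -/
theorem kolmogorov_superposition (d : ℕ) (hd : 1 ≤ d)
    (f : (Fin d → Set.Icc (0 : ℝ) 1) → ℝ) (hf : Continuous f) :
    ∃ (Φ1 : Fin (2 * d + 1) → Fin d → Set.Icc (0 : ℝ) 1 → ℝ)
      (Φ2 : Fin (2 * d + 1) → ℝ → ℝ),
      (∀ i j, Continuous (Φ1 i j)) ∧ (∀ i, Continuous (Φ2 i)) ∧
      ∀ x : Fin d → Set.Icc (0 : ℝ) 1,
        f x = ∑ i : Fin (2 * d + 1), Φ2 i (∑ j : Fin d, Φ1 i j (x j)) := by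
  obtain ⟨φ, hφ⟩ := KolmogorovSuperposition.exists_surjective_superpose d
  obtain ⟨g, hg⟩ := hφ ⟨f, hf⟩
  refine ⟨fun i j => φ i j, fun i => g i, fun i j => (φ i j).continuous,
    fun i => (g i).continuous, fun x => ?_⟩
  rw [← KolmogorovSuperposition.superpose_apply, hg]
  rfl
end

section
/- KANE exact representation: Let d ≥ 1 and let f : [0,1]^d → ℝ be continuous with 0 < f(x) < 1 for every x ∈ [0,1]^d. Then there exist continuous one-dimensional functions Φ¹_{i,j} : [0,1] → ℝ (for i = 1, …, 2d+1 and j = 1, …, d) and continuous one-dimensional functions Φ²_i : ℝ → ℝ (for i = 1, …, 2d+1) such that for every x ∈ [0,1]^d, f(x) = g( Σ_{i=1}^{2d+1} Φ²_i ( Σ_{j=1}^{d} Φ¹_{i,j}(x_j) ) ), where g(t) = 1/(1 + exp(−t)) is the sigmoid activation function. -/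
open scoped BigOperators

open Set Topology BoundedContinuousFunction unitInterval

/-- Two terms of an arithmetic progression of step `1 / n` and length `n` cannot both have
fractional part less than `1 / n`. -/
lemma eq_of_fract_lt_inv {n : ℕ} (a : ℝ) {i j : Fin n}
    (hi : Int.fract (a + i / n) * n < 1) (hj : Int.fract (a + j / n) * n < 1) : i = j := by
  have hn : (0 : ℝ) < n := by exact_mod_cast i.pos
  wlog hij : i ≤ j generalizing i j
  · exact (this hj hi (le_of_not_ge hij)).symm
  have hi0 := mul_nonneg (Int.fract_nonneg (a + i / n)) hn.le
  have hj0 := mul_nonneg (Int.fract_nonneg (a + j / n)) hn.le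
  set p := ⌊a + (i : ℝ) / n⌋ with hp
  set q := ⌊a + (j : ℝ) / n⌋ with hq
  have key : ((q - p) * n : ℝ) - (j - i)
      = Int.fract (a + i / n) * n - Int.fract (a + j / n) * n := by
    rw [Int.fract, Int.fract, ← hp, ← hq]
    field_simp
    ring
  have h1 : (((q - p) * n - (j - i) : ℤ) : ℝ) < ((1 : ℤ) : ℝ) := by push_cast; linarith
  have h2 : ((-1 : ℤ) : ℝ) < (((q - p) * n - (j - i) : ℤ) : ℝ) := by push_cast; linarith
  rw [Int.cast_lt] at h1 h2
  have h3 : (q - p) * n = ((j : ℕ) - (i : ℕ) : ℤ) := by omega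
  have hjn : ((j : ℕ) : ℤ) < n := by exact_mod_cast j.2
  have hij' : (i : ℕ) ≤ (j : ℕ) := hij
  have h4 : q - p = 0 := by
    have hn' : (0 : ℤ) < n := by exact_mod_cast i.pos
    have h5 : q - p < 1 := by
      by_contra! h
      nlinarith [h3, mul_le_mul_of_nonneg_right h hn'.le]
    have h6 : -1 < q - p := by
      by_contra! h
      nlinarith [h3, mul_le_mul_of_nonneg_right h hn'.le]
    omega
  rw [h4] at h3
  exact Fin.ext (by omega)

/-- The staircase equal to `⌊v⌋ + 1` when `Int.fract v ≥ 1 / n`, linear in between. -/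
lemma continuous_add_min_fract (n : ℕ) (hn : 1 ≤ n) :
    Continuous fun v : ℝ => v + (min (Int.fract v * n) 1 - Int.fract v) := by
  refine continuous_id.add ?_
  refine ContinuousOn.comp_fract (s := id) (f := fun _ : ℝ => fun w : ℝ => min (w * n) 1 - w)
    (Continuous.continuousOn (by simp only [Function.uncurry_def]; fun_prop)) continuous_id ?_
  have : (1 : ℝ) ≤ n := by exact_mod_cast hn
  simp [this]

/-- There are `n` continuous self-maps of the unit interval, uniformly close to the identity,
such that every point is sent into a fixed finite set by all of them but at most one. -/
lemma exists_collapsing_maps (n : ℕ) {η : ℝ} (hη : 0 < η) :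
    ∃ (r : Fin n → C(I, I)) (S : Finset I), (∀ i x, dist (r i x) x < η) ∧
      ∀ x i j, r i x ∉ S → r j x ∉ S → i = j := by
  obtain ⟨m, hm⟩ := exists_nat_one_div_lt hη
  set M : ℝ := (m : ℝ) + 1 with hM
  have hM0 : 0 < M := by positivity
  let ρ : ℝ → ℝ := fun v => v + (min (Int.fract v * n) 1 - Int.fract v)
  let r : Fin n → I → I := fun i x =>
    projIcc 0 1 zero_le_one ((ρ (M * x + i / n) - i / n) / M)
  have hr : ∀ i, Continuous (r i) := fun i => by
    have := continuous_add_min_fract n i.pos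
    exact continuous_projIcc.comp
      (((this.comp (by fun_prop : Continuous fun x : I => M * (x : ℝ) + i / n)).sub
        continuous_const).div_const M)
  classical
  refine ⟨fun i => ⟨r i, hr i⟩, Finset.univ.biUnion fun i : Fin n =>
    (Finset.range (m + 3)).image fun k : ℕ =>
      projIcc (0 : ℝ) 1 zero_le_one (((k : ℝ) - i / n) / M), fun i x => ?_, fun x i j hi hj => ?_⟩
  · have hn : (1 : ℝ) ≤ n := by exact_mod_cast i.pos
    have h1 : |(r i x : ℝ) - x| ≤ |(ρ (M * x + i / n) - i / n) / M - x| := by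
      have := abs_projIcc_sub_projIcc (a := (0 : ℝ)) (b := 1) zero_le_one
        (c := (ρ (M * x + i / n) - i / n) / M) (d := x)
      rwa [projIcc_val] at this
    have h2 : (ρ (M * x + i / n) - i / n) / M - x = (min (Int.fract (M * x + i / n) * n) 1 -
        Int.fract (M * x + i / n)) / M := by
      simp only [ρ]
      field_simp
      ring
    have h3 := Int.fract_nonneg (M * x + (i : ℝ) / n)
    have h4 := Int.fract_lt_one (M * x + (i : ℝ) / n)
    have h5 : |min (Int.fract (M * x + i / n) * n) 1 - Int.fract (M * x + i / n)| ≤ 1 := by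
      rw [abs_le]
      constructor
      · have : 0 ≤ min (Int.fract (M * x + (i : ℝ) / n) * n) 1 := by positivity
        linarith
      · linarith [min_le_right (Int.fract (M * x + (i : ℝ) / n) * n) 1]
    rw [h2, abs_div, abs_of_pos hM0] at h1
    rw [Subtype.dist_eq, Real.dist_eq]
    exact (h1.trans (div_le_div_of_nonneg_right h5 hM0.le)).trans_lt hm
  · have key : ∀ i : Fin n, r i x ∉ (Finset.univ.biUnion fun i : Fin n =>
        (Finset.range (m + 3)).image fun k : ℕ =>
          projIcc (0 : ℝ) 1 zero_le_one (((k : ℝ) - i / n) / M)) →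
        Int.fract (M * x + i / n) * n < 1 := by
      intro i hi
      by_contra! h
      apply hi
      have hn : (0 : ℝ) < n := by exact_mod_cast i.pos
      have hx0 : 0 ≤ M * x + (i : ℝ) / n := by
        have := x.2.1
        positivity
      have hx1 : M * x + (i : ℝ) / n < m + 2 := by
        have h1 : (i : ℝ) / n < 1 := by
          rw [div_lt_one hn]; exact_mod_cast i.2
        have h2 : M * x ≤ M * 1 := mul_le_mul_of_nonneg_left x.2.2 hM0.le
        linarith
      simp only [Finset.mem_biUnion, Finset.mem_univ, true_and, Finset.mem_image, Finset.mem_range]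
      refine ⟨i, ⌊M * x + (i : ℝ) / n⌋₊ + 1, ?_, ?_⟩
      · have : ⌊M * x + (i : ℝ) / n⌋₊ < m + 2 := by
          rw [Nat.floor_lt hx0]; exact_mod_cast hx1
        omega
      · simp only [r, ρ]
        congr 3
        rw [min_eq_right h, Nat.cast_add, natCast_floor_eq_intCast_floor hx0, Int.fract]
        push_cast
        ring
    exact eq_of_fract_lt_inv (M * x) (key i hi) (key j hj)

open Polynomial in
/-- A function on a finite subset of `ℝᵈ` becomes injective after adding a suitable small
linear functional. -/
lemma exists_injOn_add_sum_pow {d : ℕ} {S : Set (Fin d → ℝ)} (hS : S.Finite)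
    (c : (Fin d → ℝ) → ℝ) {δ : ℝ} (hδ : 0 < δ) :
    ∃ t, 0 < t ∧ t < δ ∧ InjOn (fun x => c x + ∑ j : Fin d, t ^ ((j : ℕ) + 1) * x j) S := by
  let P : (Fin d → ℝ) → ℝ[X] := fun x => Polynomial.C (c x) + ∑ j : Fin d, Polynomial.C (x j) * X ^ ((j : ℕ) + 1)
  have hP : ∀ x y, P x = P y → x = y := by
    intro x y h
    funext j
    have hcoeff : ∀ z, (P z).coeff ((j : ℕ) + 1) = z j := by
      intro z
      simp [P, finsetSum_coeff, coeff_X_pow, Fin.val_inj]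
    rw [← hcoeff x, h, hcoeff y]
  have hbad : (⋃ p ∈ (S ×ˢ S) ∩ {p | p.1 ≠ p.2}, {t : ℝ | (P p.1 - P p.2).IsRoot t}).Finite := by
    refine ((hS.prod hS).inter_of_left _).biUnion fun p hp => ?_
    exact Polynomial.finite_setOfPred_isRoot (sub_ne_zero.mpr fun h => hp.2 (hP _ _ h))
  obtain ⟨t, ht, htbad⟩ := ((Ioo_infinite hδ).sdiff hbad).nonempty
  refine ⟨t, ht.1, ht.2, fun x hx y hy hxy => ?_⟩
  by_contra hne
  refine htbad (mem_biUnion (x := (x, y)) ⟨⟨hx, hy⟩, hne⟩ ?_)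
  have heval : ∀ z, (P z).eval t = c z + ∑ j : Fin d, t ^ ((j : ℕ) + 1) * z j := by
    intro z
    simp only [P, eval_add, eval_C, eval_finsetSum, eval_mul, eval_pow, eval_X]
    exact congrArg _ (Finset.sum_congr rfl fun j _ => mul_comm _ _)
  simpa [heval, sub_eq_zero] using hxy

/-- If every `y` is approximated by the image of a vector of controlled norm, up to an error of
relative size `ρ < 1`, then the continuous linear map is surjective. -/
lemma ContinuousLinearMap.surjective_of_approx_preimage {E F : Type*} [NormedAddCommGroup E]
    [NormedSpace ℝ E] [CompleteSpace E] [NormedAddCommGroup F] [NormedSpace ℝ F] (T : E →L[ℝ] F)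
    {K ρ : ℝ} (hρ0 : 0 ≤ ρ) (hρ : ρ < 1)
    (h : ∀ y, ∃ x, ‖x‖ ≤ K * ‖y‖ ∧ ‖y - T x‖ ≤ ρ * ‖y‖) : Function.Surjective T := by
  intro y
  choose g hgK hgρ using h
  let u : ℕ → F := fun k => (fun z => z - T (g z))^[k] y
  have hu_succ : ∀ k, u (k + 1) = u k - T (g (u k)) := fun k =>
    Function.iterate_succ_apply' _ _ _
  have hu : ∀ k, ‖u k‖ ≤ ρ ^ k * ‖y‖ := by
    intro k
    induction k with
    | zero => simp [u]
    | succ k ih =>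
      rw [hu_succ, pow_succ', mul_assoc]
      exact (hgρ _).trans (mul_le_mul_of_nonneg_left ih hρ0)
  have hgeo : Summable fun k : ℕ => |K| * (ρ ^ k * ‖y‖) :=
    ((summable_geometric_of_lt_one hρ0 hρ).mul_right _).mul_left _
  have hsum : Summable fun k => g (u k) := by
    refine Summable.of_norm_bounded hgeo fun k => ?_
    calc ‖g (u k)‖ ≤ K * ‖u k‖ := hgK _
      _ ≤ |K| * ‖u k‖ := mul_le_mul_of_nonneg_right (le_abs_self K) (norm_nonneg _)
      _ ≤ |K| * (ρ ^ k * ‖y‖) := mul_le_mul_of_nonneg_left (hu k) (abs_nonneg K)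
  have hpart : ∀ k, T (∑ i ∈ Finset.range k, g (u i)) = y - u k := by
    intro k
    induction k with
    | zero => simp [u]
    | succ k ih => rw [Finset.sum_range_succ, map_add, ih, hu_succ]; abel
  have hu0 : Filter.Tendsto u Filter.atTop (𝓝 0) := by
    refine squeeze_zero_norm hu ?_
    simpa using (tendsto_pow_atTop_nhds_zero_of_lt_one hρ0 hρ).mul_const ‖y‖
  refine ⟨∑' k, g (u k), tendsto_nhds_unique
    ((T.continuous.tendsto _).comp hsum.hasSum.tendsto_sum_nat) ?_⟩
  simpa [Function.comp_def, hpart] using hu0.const_sub y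

/-- The linear map sending outer functions to the Kolmogorov superposition with given inner
functions. -/
noncomputable def superposition {n d : ℕ} (Φ : Fin n → Fin d → C(I, ℝ)) :
    (Fin n → (ℝ →ᵇ ℝ)) →L[ℝ] C(Fin d → I, ℝ) :=
  LinearMap.mkContinuous
    { toFun := fun φ => ⟨fun x => ∑ i, φ i (∑ j, Φ i j (x j)), by fun_prop⟩
      map_add' := fun φ ψ => by ext x; simp [Finset.sum_add_distrib]
      map_smul' := fun a φ => by ext x; simp [Finset.mul_sum] } n fun φ => by
    refine (ContinuousMap.norm_le _ (by positivity)).2 fun x => ?_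
    refine (norm_sum_le _ _).trans ((Finset.sum_le_card_nsmul Finset.univ _ ‖φ‖ fun i _ =>
      ((φ i).norm_coe_le_norm _).trans (norm_le_pi_norm φ i)).trans (by simp))

lemma superposition_apply {n d : ℕ} (Φ : Fin n → Fin d → C(I, ℝ)) (φ : Fin n → (ℝ →ᵇ ℝ))
    (x : Fin d → I) : superposition Φ φ x = ∑ i, φ i (∑ j, Φ i j (x j)) := rfl

/-- A fixed choice of outer functions depends continuously on the inner functions. -/
lemma continuous_superposition {n d : ℕ} (φ : Fin n → (ℝ →ᵇ ℝ)) :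
    Continuous fun Φ : Fin n → Fin d → C(I, ℝ) => superposition Φ φ := by
  let G : C((Fin n → Fin d → C(I, ℝ)) × (Fin d → I), ℝ) :=
    ⟨fun q => ∑ i, φ i (∑ j, q.1 i j (q.2 j)), by fun_prop⟩
  exact G.curry.continuous

/-- The inner functions for which some outer functions bounded by `‖f‖` approximate `f` with
relative error less than `ρ`. -/
def approximatingInner (n d : ℕ) (ρ : ℝ) (f : C(Fin d → I, ℝ)) :
    Set (Fin n → Fin d → C(I, ℝ)) :=
  {Φ | ∃ φ, ‖φ‖ ≤ ‖f‖ ∧ ‖f - superposition Φ φ‖ < ρ * ‖f‖}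

lemma isOpen_approximatingInner (n d : ℕ) (ρ : ℝ) (f : C(Fin d → I, ℝ)) :
    IsOpen (approximatingInner n d ρ f) := by
  have : approximatingInner n d ρ f = ⋃ φ : {φ : Fin n → (ℝ →ᵇ ℝ) // ‖φ‖ ≤ ‖f‖},
      {Φ | ‖f - superposition Φ φ‖ < ρ * ‖f‖} := by
    ext Φ
    simp [approximatingInner]
  rw [this]
  exact isOpen_iUnion fun φ =>
    isOpen_lt (continuous_const.sub (continuous_superposition φ.1)).norm continuous_const

/-- If at most `d` of `2d + 1` numbers are only known to be bounded by `N`, and the others are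
within `N / (4 (d + 1))` of `y`, then their sum is `(d + 1) y` up to `(d + 1 / 2) N`. -/
lemma abs_mul_sub_sum_lt {d : ℕ} {y N : ℝ} (hN : 0 < N) (hy : |y| ≤ N)
    (c : Fin (2 * d + 1) → ℝ) (B : Finset (Fin (2 * d + 1))) (hB : B.card ≤ d)
    (hbad : ∀ i ∈ B, |c i| ≤ N) (hgood : ∀ i ∉ B, |y - c i| ≤ N / (4 * (d + 1))) :
    |(d + 1) * y - ∑ i, c i| ≤ (d + 1 / 2) * N := by
  have hcard : (Bᶜ.card : ℝ) = 2 * d + 1 - B.card := by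
    have := Finset.card_add_card_compl B
    rw [Fintype.card_fin] at this
    have h' : (B.card : ℝ) + Bᶜ.card = 2 * d + 1 := by exact_mod_cast this
    linarith
  have hB' : (B.card : ℝ) ≤ d := by exact_mod_cast hB
  have h1 : |∑ i ∈ Bᶜ, (y - c i)| ≤ Bᶜ.card * (N / (4 * (d + 1))) := by
    refine (Finset.abs_sum_le_sum_abs _ _).trans ((Finset.sum_le_card_nsmul _ _ _ fun i hi =>
      hgood i (Finset.mem_compl.1 hi)).trans (by simp))
  have h2 : |∑ i ∈ B, c i| ≤ B.card * N := by
    refine (Finset.abs_sum_le_sum_abs _ _).trans ((Finset.sum_le_card_nsmul _ _ _ hbad).trans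
      (by simp))
  have h3 : (d + 1) * y - ∑ i, c i
      = ∑ i ∈ Bᶜ, (y - c i) - (d - B.card) * y - ∑ i ∈ B, c i := by
    rw [← Finset.sum_add_sum_compl B c, Finset.sum_sub_distrib, Finset.sum_const, nsmul_eq_mul,
      hcard]
    ring
  have h4 : |((d : ℝ) - B.card) * y| ≤ (d - B.card) * N := by
    rw [abs_mul, abs_of_nonneg (by linarith)]
    exact mul_le_mul_of_nonneg_left hy (by linarith)
  have h5 : Bᶜ.card * (N / (4 * ((d : ℝ) + 1))) ≤ N / 2 := by
    have h6 : (Bᶜ.card : ℝ) ≤ 2 * (d + 1) := by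
      rw [hcard]; linarith [(Nat.cast_nonneg B.card : (0 : ℝ) ≤ B.card)]
    refine (mul_le_mul_of_nonneg_right h6 (by positivity)).trans (le_of_eq ?_)
    field_simp
    norm_num
  rw [h3]
  rw [abs_le] at *
  constructor <;> linarith [h1.1, h1.2, h2.1, h2.2, h4.1, h4.2]

/-- Interpolation of finitely many values by a bounded continuous function. -/
lemma exists_norm_le_interpolation {Z : Type*} [Finite Z] {e : Z → ℝ} (he : Function.Injective e)
    (v : Z → ℝ) {N : ℝ} (hN : 0 ≤ N) (hv : ∀ p, |v p| ≤ N) :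
    ∃ φ : ℝ →ᵇ ℝ, ‖φ‖ ≤ N ∧ ∀ p, φ (e p) = v p := by
  let _ : TopologicalSpace Z := ⊥
  have : DiscreteTopology Z := ⟨rfl⟩
  let F : Z →ᵇ ℝ := BoundedContinuousFunction.mkOfCompact ⟨v, continuous_of_discreteTopology⟩
  obtain ⟨φ, hφ, hφF⟩ := BoundedContinuousFunction.exists_extension_norm_eq_of_isClosedEmbedding
    F (Continuous.isClosedEmbedding continuous_of_discreteTopology he)
  exact ⟨φ, hφ.trans_le ((BoundedContinuousFunction.norm_le hN).2 hv), fun p => congrFun hφF p⟩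

lemma dist_add_pow_mul_lt {a b t ε : ℝ} (ht0 : 0 ≤ t) (ht : t < min 1 (ε / 2))
    (hab : dist a b < ε / 2) (k : ℕ) (y : I) : dist (a + t ^ (k + 1) * y) b < ε := by
  have h2 : |t ^ (k + 1) * (y : ℝ)| < ε / 2 := by
    rw [abs_of_nonneg (mul_nonneg (pow_nonneg ht0 _) y.2.1), pow_succ]
    have h3 : t ^ k ≤ 1 := pow_le_one₀ ht0 (ht.le.trans (min_le_left _ _))
    calc t ^ k * t * (y : ℝ) ≤ 1 * t * 1 :=
          mul_le_mul (mul_le_mul_of_nonneg_right h3 ht0) y.2.2 y.2.1 (by linarith)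
      _ < ε / 2 := by linarith [min_le_right 1 (ε / 2)]
  rw [Real.dist_eq] at hab ⊢
  rw [abs_lt] at *
  constructor <;> linarith [hab.1, hab.2, h2.1, h2.2]

lemma dense_approximatingInner (d : ℕ) {f : C(Fin d → I, ℝ)} (hf : f ≠ 0) {ρ : ℝ}
    (hρ : ((d : ℝ) + 1 / 2) / (d + 1) < ρ) : Dense (approximatingInner (2 * d + 1) d ρ f) := by
  have hN : 0 < ‖f‖ := norm_pos_iff.2 hf
  rw [Metric.dense_iff]
  intro Φ ε hε
  have hfuc := Metric.uniformContinuous_iff.1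
    (CompactSpace.uniformContinuous_of_continuous f.continuous) (‖f‖ / (4 * (d + 1)))
    (by positivity)
  obtain ⟨η₁, hη₁, hfη⟩ := hfuc
  have hΦuc : UniformContinuous fun x : I => fun i j => Φ i j x :=
    CompactSpace.uniformContinuous_of_continuous (by fun_prop)
  obtain ⟨η₂, hη₂, hΦη⟩ := Metric.uniformContinuous_iff.1 hΦuc (ε / 2) (by positivity)
  obtain ⟨r, S, hrη, hrS⟩ := exists_collapsing_maps (2 * d + 1) (lt_min hη₁ hη₂)
  let Z := {p : Fin d → I // ∀ j, p j ∈ S}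
  have : Finite Z := (Set.Finite.pi' fun _ => S.finite_toSet).to_subtype
  let e : Z → Fin d → ℝ := fun p j => p.1 j
  have he : Function.Injective e := fun p q h =>
    Subtype.ext (funext fun j => Subtype.ext (congrFun h j))
  have ht : ∀ i, ∃ t, 0 < t ∧ t < min 1 (ε / 2) ∧
      Function.Injective fun p : Z => ∑ j, (Φ i j (p.1 j) + t ^ ((j : ℕ) + 1) * (p.1 j : ℝ)) := by
    intro i
    obtain ⟨t, ht0, ht1, hinj⟩ := exists_injOn_add_sum_pow (finite_range e)
      (fun x => ∑ j, Φ i j (projIcc 0 1 zero_le_one (x j))) (lt_min one_pos (half_pos hε))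
    refine ⟨t, ht0, ht1, fun p q hpq => he (hinj (mem_range_self p) (mem_range_self q) ?_)⟩
    simpa [e, Finset.sum_add_distrib] using hpq
  choose t ht0 htε hinj using ht
  let Ψ : Fin (2 * d + 1) → Fin d → C(I, ℝ) := fun i j =>
    ⟨fun x => Φ i j (r i x) + t i ^ ((j : ℕ) + 1) * (r i x : ℝ), by fun_prop⟩
  have hφ : ∀ i, ∃ φ : ℝ →ᵇ ℝ, ‖φ‖ ≤ ‖f‖ ∧ ∀ p : Z,
      φ (∑ j, (Φ i j (p.1 j) + t i ^ ((j : ℕ) + 1) * (p.1 j : ℝ))) = f p.1 := by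
    intro i
    exact exists_norm_le_interpolation (hinj i) (fun p => f p.1) (norm_nonneg _)
      fun p => f.norm_coe_le_norm p.1
  choose φ hφN hφf using hφ
  have hd : (0 : ℝ) < d + 1 := by positivity
  refine ⟨Ψ, ?_, fun i => ((d : ℝ) + 1)⁻¹ • φ i, ?_, ?_⟩
  · rw [Metric.mem_ball, dist_pi_lt_iff hε]
    intro i
    rw [dist_pi_lt_iff hε]
    intro j
    rw [ContinuousMap.dist_lt_iff hε]
    intro x
    have h1 : dist (Φ i j (r i x)) (Φ i j x) < ε / 2 :=
      (dist_pi_lt_iff (half_pos hε)).1 ((dist_pi_lt_iff (half_pos hε)).1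
        (hΦη ((hrη i x).trans_le (min_le_right _ _))) i) j
    exact dist_add_pow_mul_lt (ht0 i).le (htε i) h1 _ _
  · refine (pi_norm_le_iff_of_nonneg (norm_nonneg _)).2 fun i => ?_
    rw [norm_smul, norm_inv, Real.norm_of_nonneg hd.le]
    have : ((d : ℝ) + 1)⁻¹ ≤ 1 := inv_le_one_of_one_le₀ (by linarith [(d.cast_nonneg : (0:ℝ) ≤ d)])
    calc ((d : ℝ) + 1)⁻¹ * ‖φ i‖ ≤ 1 * ‖f‖ :=
          mul_le_mul this (hφN i) (norm_nonneg _) zero_le_one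
      _ = ‖f‖ := one_mul _
  · refine lt_of_le_of_lt ?_ (mul_lt_mul_of_pos_right hρ hN)
    refine (ContinuousMap.norm_le _ (by positivity)).2 fun x => ?_
    classical
    let B : Finset (Fin (2 * d + 1)) :=
      Finset.univ.biUnion fun j : Fin d => Finset.univ.filter fun i => r i (x j) ∉ S
    have hB : B.card ≤ d := by
      refine (Finset.card_biUnion_le_card_mul _ _ 1 fun j _ => ?_).trans (by simp)
      exact Finset.card_le_one.2 fun a ha b hb =>
        hrS (x j) a b (Finset.mem_filter.1 ha).2 (Finset.mem_filter.1 hb).2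
    have key := abs_mul_sub_sum_lt hN (f.norm_coe_le_norm x)
      (fun i => φ i (∑ j, Ψ i j (x j))) B hB
      (fun i _ => ((φ i).norm_coe_le_norm _).trans (hφN i)) (fun i hi => by
        have hp : ∀ j, r i (x j) ∈ S := by
          intro j
          by_contra h
          exact hi (Finset.mem_biUnion.2 ⟨j, Finset.mem_univ _, by simpa using h⟩)
        have h1 : φ i (∑ j, Ψ i j (x j)) = f fun j => r i (x j) :=
          hφf i ⟨fun j => r i (x j), hp⟩
        rw [h1, abs_sub_comm]
        exact (hfη ((dist_pi_lt_iff hη₁).2 fun j =>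
          (hrη i (x j)).trans_le (min_le_left _ _))).le)
    rw [ContinuousMap.sub_apply, superposition_apply, Real.norm_eq_abs]
    have h2 : f x - ∑ i, (((d : ℝ) + 1)⁻¹ • φ i) (∑ j, Ψ i j (x j))
        = ((d + 1) * f x - ∑ i, φ i (∑ j, Ψ i j (x j))) / (d + 1) := by
      simp only [BoundedContinuousFunction.coe_smul, smul_eq_mul, ← Finset.mul_sum]
      field_simp
    rw [h2, abs_div, abs_of_pos hd, div_mul_eq_mul_div]
    exact div_le_div_of_nonneg_right key hd.le

/-- **Kolmogorov superposition theorem**: there are inner functions through which every continuous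
function on the cube factors. -/
theorem exists_surjective_superposition (d : ℕ) :
    ∃ Φ : Fin (2 * d + 1) → Fin d → C(I, ℝ), Function.Surjective (superposition Φ) := by
  have hd : (0 : ℝ) < d + 1 := by positivity
  set κ : ℝ := 1 / (8 * (d + 1)) with hκ
  have hκ0 : 0 < κ := by positivity
  have hκ1 : κ ≤ 1 / 8 := by
    rw [hκ, div_le_div_iff_of_pos_left one_pos (by positivity) (by norm_num)]
    linarith [(d.cast_nonneg : (0 : ℝ) ≤ d)]
  have hρ : ((d : ℝ) + 1 / 2) / (d + 1) < 1 - 3 * κ := by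
    have : ((d : ℝ) + 1 / 2) / (d + 1) = 1 - 4 * κ := by rw [hκ]; field_simp; ring
    linarith
  obtain ⟨D, hDc, hD⟩ := TopologicalSpace.exists_countable_dense C(Fin d → I, ℝ)
  have : CompleteSpace (Fin (2 * d + 1) → Fin d → C(I, ℝ)) := Pi.complete _
  have : BaireSpace (Fin (2 * d + 1) → Fin d → C(I, ℝ)) :=
    BaireSpace.of_completelyPseudoMetrizable
  obtain ⟨Φ, hΦ⟩ := (dense_biInter_of_isOpen (S := D \ {0})
    (fun f _ => isOpen_approximatingInner (2 * d + 1) d (1 - 3 * κ) f) (hDc.mono sdiff_subset)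
    fun f hf => dense_approximatingInner d hf.2 hρ).nonempty
  rw [mem_iInter₂] at hΦ
  refine ⟨Φ, (superposition Φ).surjective_of_approx_preimage (K := 2) (ρ := 1 - κ) (by linarith)
    (by linarith) fun f => ?_⟩
  rcases eq_or_ne f 0 with rfl | hf
  · exact ⟨0, by simp⟩
  have hN : 0 < ‖f‖ := norm_pos_iff.2 hf
  obtain ⟨f', hf'D, hff'⟩ := Metric.dense_iff.1 hD f (κ * ‖f‖) (by positivity)
    |>.imp fun _ h => And.symm h
  rw [Metric.mem_ball, dist_comm, dist_eq_norm] at hff'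
  have h1 : ‖f'‖ ≤ ‖f‖ + κ * ‖f‖ := by
    have := norm_le_norm_add_norm_sub f f'
    linarith
  have hf'0 : f' ≠ 0 := by
    rintro rfl
    rw [sub_zero] at hff'
    nlinarith
  obtain ⟨φ, hφ, hφf⟩ := hΦ f' ⟨hf'D, hf'0⟩
  refine ⟨φ, by nlinarith, ?_⟩
  have h2 := norm_sub_le_norm_sub_add_norm_sub f f' (superposition Φ φ)
  have h3 : (1 - 3 * κ) * ‖f'‖ ≤ (1 - 3 * κ) * (‖f‖ + κ * ‖f‖) :=
    mul_le_mul_of_nonneg_left h1 (by linarith)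
  nlinarith [mul_pos hκ0 hN, mul_pos (mul_pos hκ0 hκ0) hN]

/-- KANE exact representation: a continuous function on the unit cube with values in
the open interval `(0,1)` can be written exactly as a sigmoid applied to a
Kolmogorov superposition expression. -/
theorem kane_exact_representation (d : ℕ) (hd : 1 ≤ d)
    (f : (Fin d → Set.Icc (0 : ℝ) 1) → ℝ) (hf : Continuous f)
    (hf01 : ∀ x, 0 < f x ∧ f x < 1) :
    ∃ (Φ1 : Fin (2 * d + 1) → Fin d → Set.Icc (0 : ℝ) 1 → ℝ)
      (Φ2 : Fin (2 * d + 1) → ℝ → ℝ),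
      (∀ i j, Continuous (Φ1 i j)) ∧ (∀ i, Continuous (Φ2 i)) ∧
      ∀ x : Fin d → Set.Icc (0 : ℝ) 1,
        f x = 1 / (1 + Real.exp
          (-(∑ i : Fin (2 * d + 1), Φ2 i (∑ j : Fin d, Φ1 i j (x j))))) := by
  obtain ⟨Φ, hΦ⟩ := exists_surjective_superposition d
  have h1 : ∀ x, 1 - f x ≠ 0 := fun x => (sub_pos.2 (hf01 x).2).ne'
  have h2 : ∀ x, 0 < f x / (1 - f x) := fun x => div_pos (hf01 x).1 (sub_pos.2 (hf01 x).2)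
  obtain ⟨φ, hφ⟩ := hΦ ⟨fun x => Real.log (f x / (1 - f x)),
    (hf.div (continuous_const.sub hf) h1).log fun x => (h2 x).ne'⟩
  refine ⟨fun i j => Φ i j, fun i => φ i, fun i j => (Φ i j).continuous,
    fun i => (φ i).continuous, fun x => ?_⟩
  have h3 : ∑ i, φ i (∑ j, Φ i j (x j)) = Real.log (f x / (1 - f x)) :=
    DFunLike.congr_fun hφ x
  rw [h3, Real.exp_neg, Real.exp_log (h2 x)]
  have h4 := (hf01 x).1.ne'
  have h5 := h1 x
  field_simp
  ring
end

section
/- KANE uniform density: Let d ≥ 1, let f : [0,1]^d → ℝ be continuous with 0 ≤ f(x) ≤ 1 for every x ∈ [0,1]^d, and let ε > 0. Then there exist continuous one-dimensional functions Φ¹_{i,j} : [0,1] → ℝ (for i = 1, …, 2d+1 and j = 1, …, d) and continuous one-dimensional functions Φ²_i : ℝ → ℝ (for i = 1, …, 2d+1) such that for every x ∈ [0,1]^d, | f(x) − g( Σ_{i=1}^{2d+1} Φ²_i ( Σ_{j=1}^{d} Φ¹_{i,j}(x_j) ) ) | ≤ ε, where g(t) = 1/(1 + exp(−t)) is the sigmoid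 activation function. -/
open scoped BigOperators

/-- The Kolmogorov superposition `x ↦ ∑ q, G q (∑ j, ψ q j (x j))`. -/
noncomputable def kolmogorovSuperposition {n d : ℕ} (G : Fin n → C(ℝ, ℝ))
    (ψ : Fin n → Fin d → C(Set.Icc (0 : ℝ) 1, ℝ)) : C(Fin d → Set.Icc (0 : ℝ) 1, ℝ) :=
  ∑ q, (G q).comp (∑ j, (ψ q j).comp (ContinuousMap.eval j))

theorem kolmogorovSuperposition_apply {n d : ℕ} (G : Fin n → C(ℝ, ℝ))
    (ψ : Fin n → Fin d → C(Set.Icc (0 : ℝ) 1, ℝ)) (x : Fin d → Set.Icc (0 : ℝ) 1) :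
    kolmogorovSuperposition G ψ x = ∑ q, G q (∑ j, ψ q j (x j)) := by
  simp [kolmogorovSuperposition, ContinuousMap.sum_apply]

theorem continuous_kolmogorovSuperposition {n d : ℕ} (G : Fin n → C(ℝ, ℝ)) :
    Continuous (kolmogorovSuperposition (d := d) G) := by
  unfold kolmogorovSuperposition
  refine continuous_finsetSum _ fun q _ => (G q).continuous_postcomp.comp ?_
  refine continuous_finsetSum _ fun j _ => (ContinuousMap.continuous_precomp _).comp ?_
  fun_prop

/-- A generic small perturbation of additive functions on an integer grid is injective. -/
theorem exists_injective_sum_add_pow {d : ℕ} (v : Fin d → ℤ → ℝ) {η : ℝ} (hη : 0 < η) :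
    ∃ s ∈ Set.Ioo 0 η, Function.Injective
      fun m : Fin d → ℤ => ∑ j, (v j (m j) + s ^ ((j : ℕ) + 1) * m j) := by
  classical
  let P : (Fin d → ℤ) × (Fin d → ℤ) → Polynomial ℝ := fun p =>
    Polynomial.C (∑ j, (v j (p.1 j) - v j (p.2 j))) +
      ∑ j : Fin d, Polynomial.C ((p.1 j : ℝ) - p.2 j) * Polynomial.X ^ ((j : ℕ) + 1)
  have hP : ∀ p : (Fin d → ℤ) × (Fin d → ℤ), p.1 ≠ p.2 → P p ≠ 0 := by
    intro p hp h0
    obtain ⟨j, hj⟩ := Function.ne_iff.mp hp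
    have h := congrArg (fun r => Polynomial.coeff r ((j : ℕ) + 1)) h0
    simp only [P, Polynomial.coeff_add, Polynomial.coeff_C_succ, Polynomial.finsetSum_coeff,
      Polynomial.coeff_C_mul, Polynomial.coeff_X_pow, Polynomial.coeff_zero, add_left_inj,
      Fin.val_inj, mul_ite, mul_one, mul_zero, Finset.sum_ite_eq, Finset.mem_univ, if_true,
      zero_add, sub_eq_zero, Int.cast_inj] at h
    exact hj h
  have hc : (⋃ p : (Fin d → ℤ) × (Fin d → ℤ), {s : ℝ | P p ≠ 0 ∧ (P p).IsRoot s}).Countable := by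
    refine Set.countable_iUnion fun p => Set.Finite.countable ?_
    by_cases h : P p = 0
    · simp [h]
    · exact (Polynomial.finite_setOfPred_isRoot h).subset fun s hs => hs.2
  obtain ⟨s, hs, hs0⟩ := (hc.dense_compl ℝ).exists_between hη
  refine ⟨s, hs0, fun m m' h => ?_⟩
  by_contra hne
  refine hs (Set.mem_iUnion.mpr ⟨(m, m'), hP _ hne, ?_⟩)
  simp only [P, Polynomial.IsRoot, Polynomial.eval_add, Polynomial.eval_C,
    Polynomial.eval_finsetSum, Polynomial.eval_mul, Polynomial.eval_pow, Polynomial.eval_X]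
  rw [← Finset.sum_add_distrib, ← sub_eq_zero.mpr h, ← Finset.sum_sub_distrib]
  exact Finset.sum_congr rfl fun j _ => by ring

/-- `n` continuous staircases, each near the identity, such that at every point at most one of them
fails to be integer valued. -/
theorem exists_staircases {n : ℕ} (hn : 0 < n) :
    ∃ S : Fin n → C(ℝ, ℝ), (∀ q t, |S q t - t| ≤ 2) ∧
      ∀ t q q', S q t ∉ Set.range ((↑) : ℤ → ℝ) → S q' t ∉ Set.range ((↑) : ℤ → ℝ) → q = q' := by
  have hn' : (1 : ℝ) ≤ n := by exact_mod_cast hn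
  let k : ℝ → ℝ := fun v => v - max 0 (n * v - (n - 1))
  have hk : Continuous (k ∘ Int.fract) := by
    refine ContinuousOn.comp_fract'' (by fun_prop) ?_
    simp only [k]
    rw [max_eq_left (by linarith), max_eq_right (by linarith)]
    ring
  have hkc : Continuous fun u : ℝ => u - k (Int.fract u) := continuous_id.sub hk
  have hkb : ∀ u : ℝ, |k (Int.fract u)| ≤ 1 := by
    intro u
    have h0 := Int.fract_nonneg u
    have h1 := (Int.fract_lt_one u).le
    have h2 : max 0 (n * Int.fract u - (n - 1)) ≤ Int.fract u :=
      max_le h0 (by nlinarith)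
    have h3 := le_max_left 0 (n * Int.fract u - (n - 1))
    rw [abs_le]
    constructor <;> simp only [k] <;> linarith
  refine ⟨fun q => ⟨fun t => (t + q / n) - k (Int.fract (t + q / n)),
    hkc.comp (continuous_id.add continuous_const)⟩, fun q t => ?_, fun t q q' hq hq' => ?_⟩
  · have h1 := abs_le.mp (hkb (t + q / n))
    have h2 : (0 : ℝ) ≤ (q : ℝ) / n := by positivity
    have h3 : (q : ℝ) / n ≤ 1 := by
      rw [div_le_one (by linarith)]
      exact_mod_cast q.2.le
    simp only [ContinuousMap.coe_mk]
    rw [abs_le]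
    constructor <;> linarith
  · have key : ∀ r : Fin n, (t + r / n) - k (Int.fract (t + r / n)) ∉ Set.range ((↑) : ℤ → ℝ) →
        (n : ℝ) - 1 < n * Int.fract (t + r / n) := by
      intro r hr
      by_contra! hle
      refine hr ⟨⌊t + (r : ℝ) / n⌋, ?_⟩
      simp only [k]
      rw [max_eq_left (by linarith), sub_zero, Int.self_sub_fract]
    have a := key q hq
    have a' := key q' hq'
    have b : (n : ℝ) * Int.fract (t + (q : ℝ) / n) < n := by
      nlinarith [Int.fract_lt_one (t + (q : ℝ) / n)]
    have b' : (n : ℝ) * Int.fract (t + (q' : ℝ) / n) < n := by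
      nlinarith [Int.fract_lt_one (t + (q' : ℝ) / n)]
    have e : ∀ r : Fin n, (n : ℝ) * Int.fract (t + (r : ℝ) / n) =
        n * t + r - n * ⌊t + (r : ℝ) / n⌋ := by
      intro r
      rw [Int.fract]
      field_simp
    rw [e] at a a' b b'
    generalize ⌊t + (q : ℝ) / n⌋ = z at *
    generalize ⌊t + (q' : ℝ) / n⌋ = z' at *
    have h1 : (((q : ℤ) - q' - n * (z - z') : ℤ) : ℝ) < (1 : ℤ) := by push_cast; linarith
    have h2 : ((-1 : ℤ) : ℝ) < (((q : ℤ) - q' - n * (z - z') : ℤ) : ℝ) := by push_cast; linarith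
    rw [Int.cast_lt] at h1 h2
    have h3 : (q : ℤ) - q' = n * (z - z') := by omega
    have h4 : (q : ℤ) - q' = 0 := by
      refine Int.eq_zero_of_abs_lt_dvd (m := n) ⟨_, h3⟩ ?_
      have := q.2
      have := q'.2
      rw [abs_lt]
      constructor <;> omega
    ext
    omega

/-- Perturbing inner functions to be constant on the cells cut out by a staircase `S`, with the cells
separated by their sum, so that an outer function reproduces `f` on all cells. -/
theorem exists_perturbation_of_staircase {d : ℕ} (f : C(Fin d → Set.Icc (0 : ℝ) 1, ℝ))
    (ψ : Fin d → C(Set.Icc (0 : ℝ) 1, ℝ)) {δ ω N : ℝ} (hδ : 0 < δ) (hN : 0 < N)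
    (hψ : ∀ j x y, dist x y ≤ 2 / N → dist (ψ j x) (ψ j y) ≤ δ)
    (hf : ∀ x y, dist x y ≤ 2 / N → dist (f x) (f y) ≤ ω)
    (S : C(ℝ, ℝ)) (hS : ∀ t, |S t - t| ≤ 2) :
    ∃ (φ : Fin d → C(Set.Icc (0 : ℝ) 1, ℝ)) (H : C(ℝ, ℝ)), (∀ j, dist (φ j) (ψ j) ≤ 2 * δ) ∧
      (∀ t, |H t| ≤ ‖f‖) ∧
      ∀ x : Fin d → Set.Icc (0 : ℝ) 1, (∀ j, S (N * x j) ∈ Set.range ((↑) : ℤ → ℝ)) →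
        |f x - H (∑ j, φ j (x j))| ≤ ω := by
  classical
  let p : ℝ → Set.Icc (0 : ℝ) 1 := fun t => Set.projIcc 0 1 zero_le_one (t / N)
  have hpc : Continuous p := continuous_projIcc.comp (by fun_prop)
  have hp : ∀ x : Set.Icc (0 : ℝ) 1, dist (p (S (N * x))) x ≤ 2 / N := by
    intro x
    have h1 := (LipschitzWith.projIcc (zero_le_one (α := ℝ))).dist_le_mul (S (N * x) / N) x
    rw [Set.projIcc_val, NNReal.coe_one, one_mul, Real.dist_eq] at h1
    refine h1.trans ?_
    have h2 : S (N * x) / N - x = (S (N * x) - N * x) / N := by field_simp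
    rw [h2, abs_div, abs_of_pos hN]
    gcongr
    exact hS _
  have hSb : ∀ x : Set.Icc (0 : ℝ) 1, |S (N * x)| ≤ N + 2 := by
    intro x
    have h := abs_le.mp (hS (N * x))
    have h0 : 0 ≤ N * x := mul_nonneg hN.le x.2.1
    have h1 : N * x ≤ N := mul_le_of_le_one_right hN.le x.2.2
    rw [abs_le]
    constructor <;> linarith
  obtain ⟨s, ⟨hs0, hs1⟩, hinj⟩ := exists_injective_sum_add_pow
    (fun j m => ψ j (p m)) (η := min 1 (δ / (N + 2))) (by positivity)
  have hs_one : s ≤ 1 := hs1.le.trans (min_le_left _ _)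
  have hs_le : s * (N + 2) ≤ δ := by
    rw [← le_div_iff₀ (by positivity)]
    exact hs1.le.trans (min_le_right _ _)
  let σ : (Fin d → ℤ) → ℝ := fun m => ∑ j, (ψ j (p (m j)) + s ^ ((j : ℕ) + 1) * m j)
  let T : Finset (Fin d → ℤ) := Fintype.piFinset fun _ => Finset.Icc (-⌈N + 2⌉) ⌈N + 2⌉
  let Q : Polynomial ℝ := Lagrange.interpolate T σ fun m => f fun j => p (m j)
  refine ⟨fun j => ⟨fun x => ψ j (p (S (N * x))) + s ^ ((j : ℕ) + 1) * S (N * x), by fun_prop⟩,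
    ⟨fun t => max (-‖f‖) (min ‖f‖ (Q.eval t)), by fun_prop⟩, fun j => ?_, fun t => ?_,
    fun x hx => ?_⟩
  · rw [ContinuousMap.dist_le (by positivity)]
    intro x
    have h1 := hψ j _ _ (hp x)
    have h2 : |s ^ ((j : ℕ) + 1) * S (N * x)| ≤ δ := by
      rw [abs_mul, abs_of_pos (pow_pos hs0 _)]
      refine le_trans ?_ hs_le
      gcongr
      · exact pow_le_of_le_one hs0.le hs_one (by omega)
      · exact hSb x
    rw [Real.dist_eq] at h1 ⊢
    simp only [ContinuousMap.coe_mk]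
    rw [add_sub_right_comm]
    exact (abs_add_le _ _).trans (by linarith)
  · have := norm_nonneg f
    rw [abs_le]
    exact ⟨le_max_left _ _, max_le (by linarith) (min_le_left _ _)⟩
  · choose m hm using hx
    have hmT : m ∈ T := by
      rw [Fintype.mem_piFinset]
      intro j
      have h := hSb (x j)
      rw [← hm j, abs_le] at h
      have hceil := Int.le_ceil (N + 2)
      rw [Finset.mem_Icc]
      constructor
      · have : ((-⌈N + 2⌉ : ℤ) : ℝ) ≤ m j := by push_cast; linarith
        exact_mod_cast this
      · have : (m j : ℝ) ≤ (⌈N + 2⌉ : ℤ) := by linarith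
        exact_mod_cast this
    have heval : Q.eval (σ m) = f fun j => p (m j) :=
      Lagrange.eval_interpolate_at_node _ hinj.injOn hmT
    have hfb := abs_le.mp (f.norm_coe_le_norm fun j => p (m j))
    simp only [ContinuousMap.coe_mk, ← hm]
    change |f x - max (-‖f‖) (min ‖f‖ (Q.eval (σ m)))| ≤ ω
    rw [heval, min_eq_right hfb.2, max_eq_right hfb.1, ← Real.dist_eq]
    refine hf _ _ ?_
    rw [dist_pi_le_iff (by positivity)]
    intro j
    rw [dist_comm, hm]
    exact hp _

/-- After an arbitrarily small perturbation of the inner functions, a superposition captures a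
fixed proportion of `f`. -/
theorem exists_superposition_contraction {d : ℕ} (f : C(Fin d → Set.Icc (0 : ℝ) 1, ℝ))
    (ψ : Fin (2 * d + 1) → Fin d → C(Set.Icc (0 : ℝ) 1, ℝ)) {δ ω : ℝ} (hδ : 0 < δ) (hω : 0 < ω) :
    ∃ (φ : Fin (2 * d + 1) → Fin d → C(Set.Icc (0 : ℝ) 1, ℝ)) (H : Fin (2 * d + 1) → C(ℝ, ℝ)),
      dist φ ψ < δ ∧
        ‖f - kolmogorovSuperposition H φ‖ ≤ 2 * d / (2 * d + 1) * ‖f‖ + ω := by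
  classical
  have huc : ∃ N : ℝ, 0 < N ∧
      (∀ q j x y, dist x y ≤ 2 / N → dist (ψ q j x) (ψ q j y) ≤ δ / 4) ∧
      ∀ x y, dist x y ≤ 2 / N → dist (f x) (f y) ≤ ω := by
    have hψ : ∀ q j, ∀ᶠ r : ℝ in nhds 0,
        ∀ x y, dist x y ≤ r → dist (ψ q j x) (ψ q j y) ≤ δ / 4 := by
      intro q j
      obtain ⟨r, hr, h⟩ := Metric.uniformContinuous_iff.mp
        (CompactSpace.uniformContinuous_of_continuous (ψ q j).continuous) (δ / 4) (by positivity)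
      filter_upwards [gt_mem_nhds hr] with r' hr' x y hxy
      exact (h (hxy.trans_lt hr')).le
    have hf : ∀ᶠ r : ℝ in nhds 0, ∀ x y, dist x y ≤ r → dist (f x) (f y) ≤ ω := by
      obtain ⟨r, hr, h⟩ := Metric.uniformContinuous_iff.mp
        (CompactSpace.uniformContinuous_of_continuous f.continuous) ω hω
      filter_upwards [gt_mem_nhds hr] with r' hr' x y hxy
      exact (h (hxy.trans_lt hr')).le
    have hlim : Filter.Tendsto (fun N : ℝ => 2 / N) Filter.atTop (nhds 0) :=
      tendsto_const_nhds.div_atTop Filter.tendsto_id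
    have hall := (Filter.eventually_all.mpr fun q => Filter.eventually_all.mpr (hψ q)).and hf
    obtain ⟨N, hN, h1, h2⟩ := ((Filter.eventually_gt_atTop 0).and (hlim.eventually hall)).exists
    exact ⟨N, hN, h1, h2⟩
  obtain ⟨N, hN, hψ, hf⟩ := huc
  obtain ⟨S, hS, hSint⟩ := exists_staircases (n := 2 * d + 1) (by omega)
  choose φ H hφ hHb hH using fun q =>
    exists_perturbation_of_staircase f (ψ q) (by positivity : 0 < δ / 4) hN (hψ q) hf (S q) (hS q)
  have hd : (0 : ℝ) < 2 * d + 1 := by positivity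
  refine ⟨φ, fun q => (2 * d + 1 : ℝ)⁻¹ • H q, ?_, ?_⟩
  · refine lt_of_le_of_lt ?_ (by linarith : 2 * (δ / 4) < δ)
    refine (dist_pi_le_iff (by positivity)).mpr fun q => ?_
    exact (dist_pi_le_iff (by positivity)).mpr fun j => hφ q j
  · rw [ContinuousMap.norm_le _ (by positivity)]
    intro x
    let bad : Fin (2 * d + 1) → Fin d → Prop := fun q j =>
      S q (N * x j) ∉ Set.range ((↑) : ℤ → ℝ)
    have hq : ∀ q, |f x - H q (∑ j, φ q j (x j))| ≤
        ω + ∑ j, if bad q j then 2 * ‖f‖ else 0 := by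
      intro q
      by_cases hgood : ∀ j, S q (N * x j) ∈ Set.range ((↑) : ℤ → ℝ)
      · refine (hH q x hgood).trans (le_add_of_nonneg_right ?_)
        exact Finset.sum_nonneg fun j _ => by split_ifs <;> positivity
      · obtain ⟨j, hj⟩ := not_forall.mp hgood
        have h1 : 2 * ‖f‖ ≤ ∑ j, if bad q j then 2 * ‖f‖ else 0 := by
          refine le_trans (le_of_eq ?_) (Finset.single_le_sum (f := fun j =>
            if bad q j then 2 * ‖f‖ else 0) (fun j _ => ?_) (Finset.mem_univ j))
          · exact (if_pos hj).symm
          · positivity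
        have h2 := hHb q (∑ j, φ q j (x j))
        have h3 : |f x| ≤ ‖f‖ := f.norm_coe_le_norm x
        exact (abs_sub _ _).trans (by linarith)
    have hbad : ∀ j, ∑ q, (if bad q j then 2 * ‖f‖ else 0) ≤ 2 * ‖f‖ := by
      intro j
      rw [← Finset.sum_filter, Finset.sum_const, nsmul_eq_mul]
      refine mul_le_of_le_one_left (by positivity) ?_
      have : (Finset.univ.filter fun q => bad q j).card ≤ 1 :=
        Finset.card_le_one.mpr fun q hq q' hq' =>
          hSint _ q q' (Finset.mem_filter.mp hq).2 (Finset.mem_filter.mp hq').2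
      exact_mod_cast this
    have hsum : ∑ q, |f x - H q (∑ j, φ q j (x j))| ≤ (2 * d + 1) * ω + d * (2 * ‖f‖) := by
      refine (Finset.sum_le_sum fun q _ => hq q).trans ?_
      rw [Finset.sum_add_distrib, Finset.sum_comm]
      refine add_le_add (by simp) ?_
      exact (Finset.sum_le_sum fun j _ => hbad j).trans (by simp)
    have heq : (f - kolmogorovSuperposition (fun q => (2 * d + 1 : ℝ)⁻¹ • H q) φ) x =
        (2 * d + 1 : ℝ)⁻¹ * ∑ q, (f x - H q (∑ j, φ q j (x j))) := by
      rw [ContinuousMap.sub_apply, kolmogorovSuperposition_apply]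
      simp only [ContinuousMap.smul_apply, smul_eq_mul, ← Finset.mul_sum,
        Finset.sum_sub_distrib, Finset.sum_const, Finset.card_univ, Fintype.card_fin,
        nsmul_eq_mul]
      push_cast
      field_simp
    rw [heq, Real.norm_eq_abs, abs_mul, abs_of_pos (inv_pos.mpr hd)]
    calc (2 * d + 1 : ℝ)⁻¹ * |∑ q, (f x - H q (∑ j, φ q j (x j)))|
        ≤ (2 * d + 1 : ℝ)⁻¹ * ((2 * d + 1) * ω + d * (2 * ‖f‖)) := by
          gcongr
          exact (Finset.abs_sum_le_sum_abs _ _).trans hsum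
      _ = 2 * d / (2 * d + 1) * ‖f‖ + ω := by
          field_simp
          ring

/-- Kolmogorov superpositions with `2 * d + 1` terms are dense in the continuous functions on the
unit cube. -/
theorem exists_norm_sub_kolmogorovSuperposition_le {d : ℕ}
    (f : C(Fin d → Set.Icc (0 : ℝ) 1, ℝ)) {ε : ℝ} (hε : 0 < ε) :
    ∃ (G : Fin (2 * d + 1) → C(ℝ, ℝ)) (ψ : Fin (2 * d + 1) → Fin d → C(Set.Icc (0 : ℝ) 1, ℝ)),
      ‖f - kolmogorovSuperposition G ψ‖ ≤ ε := by
  set θ : ℝ := 2 * d / (2 * d + 1) with hθ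
  have hθ0 : 0 ≤ θ := by positivity
  have hθ1 : θ < 1 := by
    rw [hθ, div_lt_one (by positivity)]
    linarith
  set τ : ℝ := (θ + 1) / 2 with hτ
  have hiter : ∀ k : ℕ, ∃ (G : Fin (2 * d + 1) → C(ℝ, ℝ))
      (ψ : Fin (2 * d + 1) → Fin d → C(Set.Icc (0 : ℝ) 1, ℝ)),
      ‖f - kolmogorovSuperposition G ψ‖ ≤ τ ^ k * (‖f‖ + 1) := by
    intro k
    induction k with
    | zero =>
      refine ⟨0, 0, ?_⟩
      have : kolmogorovSuperposition (0 : Fin (2 * d + 1) → C(ℝ, ℝ))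
          (0 : Fin (2 * d + 1) → Fin d → C(Set.Icc (0 : ℝ) 1, ℝ)) = 0 := by
        ext x
        simp [kolmogorovSuperposition_apply]
      rw [this, sub_zero, pow_zero, one_mul]
      linarith
    | succ k ih =>
      obtain ⟨G, ψ, h⟩ := ih
      set b := τ ^ k * (‖f‖ + 1) with hb
      have hb0 : 0 < b := by positivity
      have hω : 0 < (1 - θ) / 4 * b := mul_pos (by linarith) hb0
      obtain ⟨δ, hδ, hcont⟩ := Metric.continuous_iff.mp
        (continuous_kolmogorovSuperposition (d := d) G) ψ _ hω
      obtain ⟨φ, H, hφ, hH⟩ := exists_superposition_contraction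
        (f - kolmogorovSuperposition G ψ) ψ hδ hω
      refine ⟨G + H, φ, ?_⟩
      have hadd : kolmogorovSuperposition (G + H) φ =
          kolmogorovSuperposition G φ + kolmogorovSuperposition H φ := by
        ext x
        simp [kolmogorovSuperposition_apply, Finset.sum_add_distrib]
      have hdist := hcont φ hφ
      rw [dist_eq_norm, norm_sub_rev] at hdist
      have hmul := mul_le_mul_of_nonneg_left h hθ0
      calc ‖f - kolmogorovSuperposition (G + H) φ‖
          = ‖(f - kolmogorovSuperposition G ψ - kolmogorovSuperposition H φ) +
              (kolmogorovSuperposition G ψ - kolmogorovSuperposition G φ)‖ := by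
            rw [hadd]
            congr 1
            abel
        _ ≤ _ := norm_add_le _ _
        _ ≤ τ ^ (k + 1) * (‖f‖ + 1) := by
            rw [pow_succ', mul_assoc, ← hb, hτ]
            linarith
  obtain ⟨k, hk⟩ := exists_pow_lt_of_lt_one (div_pos hε (by positivity : 0 < ‖f‖ + 1))
    (by linarith : τ < 1)
  obtain ⟨G, ψ, h⟩ := hiter k
  exact ⟨G, ψ, h.trans ((lt_div_iff₀ (by positivity)).mp hk).le⟩

theorem Real.lipschitzWith_sigmoid : LipschitzWith 1 Real.sigmoid := by
  refine lipschitzWith_of_nnnorm_deriv_le differentiable_sigmoid fun x => ?_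
  rw [← NNReal.coe_le_coe, coe_nnnorm, Real.deriv_sigmoid, Real.norm_eq_abs, NNReal.coe_one,
    abs_le]
  have h0 := Real.sigmoid_pos x
  have h1 := Real.sigmoid_lt_one x
  constructor <;> nlinarith

/-- KANE uniform density: a continuous function on the unit cube with values in
`[0,1]` can be uniformly approximated, within any `ε > 0`, by a sigmoid applied
to a Kolmogorov superposition expression. -/
theorem kane_uniform_density (d : ℕ) (hd : 1 ≤ d)
    (f : (Fin d → Set.Icc (0 : ℝ) 1) → ℝ) (hf : Continuous f)
    (hf01 : ∀ x, 0 ≤ f x ∧ f x ≤ 1) (ε : ℝ) (hε : 0 < ε) :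
    ∃ (Φ1 : Fin (2 * d + 1) → Fin d → Set.Icc (0 : ℝ) 1 → ℝ)
      (Φ2 : Fin (2 * d + 1) → ℝ → ℝ),
      (∀ i j, Continuous (Φ1 i j)) ∧ (∀ i, Continuous (Φ2 i)) ∧
      ∀ x : Fin d → Set.Icc (0 : ℝ) 1,
        |f x - 1 / (1 + Real.exp
          (-(∑ i : Fin (2 * d + 1), Φ2 i (∑ j : Fin d, Φ1 i j (x j)))))| ≤ ε := by
  obtain ⟨η, hη0, hη⟩ := exists_between (by positivity : 0 < min (ε / 2) (1 / 2))
  obtain ⟨hηε, hη2⟩ := lt_min_iff.mp hη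
  let g : (Fin d → Set.Icc (0 : ℝ) 1) → ℝ := fun x => η + (1 - 2 * η) * f x
  have hg0 : ∀ x, 0 < g x := fun x => by
    have := mul_nonneg (by linarith : 0 ≤ 1 - 2 * η) (hf01 x).1
    simp only [g]
    linarith
  have hg1 : ∀ x, g x < 1 := fun x => by
    have := mul_le_of_le_one_right (by linarith : 0 ≤ 1 - 2 * η) (hf01 x).2
    simp only [g]
    linarith
  have hgf : ∀ x, |f x - g x| ≤ η := fun x => by
    obtain ⟨h0, h1⟩ := hf01 x
    rw [abs_le]
    constructor <;> simp only [g] <;> nlinarith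
  have hgc : Continuous g := by fun_prop
  have hpos : ∀ x, 0 < (g x)⁻¹ - 1 := fun x => sub_pos.mpr ((one_lt_inv₀ (hg0 x)).mpr (hg1 x))
  let F : C(Fin d → Set.Icc (0 : ℝ) 1, ℝ) :=
    ⟨fun x => -Real.log ((g x)⁻¹ - 1),
      (((hgc.inv₀ fun x => (hg0 x).ne').sub continuous_const).log fun x => (hpos x).ne').neg⟩
  have hF : ∀ x, Real.sigmoid (F x) = g x := fun x => by
    simp [F, Real.sigmoid_def, Real.exp_log (hpos x)]
  obtain ⟨G, ψ, h⟩ := exists_norm_sub_kolmogorovSuperposition_le F (half_pos hε)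
  refine ⟨fun i j => ψ i j, fun i => G i, fun i j => (ψ i j).continuous,
    fun i => (G i).continuous, fun x => ?_⟩
  rw [← kolmogorovSuperposition_apply, one_div, ← Real.sigmoid_def]
  have h1 := Real.lipschitzWith_sigmoid.dist_le_mul (F x) (kolmogorovSuperposition G ψ x)
  have h2 : |F x - kolmogorovSuperposition G ψ x| ≤ ε / 2 :=
    ((F - kolmogorovSuperposition G ψ).norm_coe_le_norm x).trans h
  rw [hF, NNReal.coe_one, one_mul, Real.dist_eq, Real.dist_eq] at h1
  have h3 := abs_sub_le (f x) (g x) (Real.sigmoid (kolmogorovSuperposition G ψ x))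
  linarith [hgf x]
end

section
/- Invariance of the probability of cascade under strictly increasing transformations (Proposition 1, infinite endpoint case): Let (Ω, 𝔉, μ) be a probability space, let Y : Ω → ℝ be a measurable function, and for each u ∈ ℝ let A(u) ⊆ Ω be a measurable event. Let α ∈ ℝ and let h : ℝ → ℝ be an order isomorphism of ℝ. If the conditional probability μ(A(u) | {ω : Y(ω) > u}) tends to α as u → +∞, then the conditional probability μ(A(h⁻¹(u)) | {ω : h(Y(ω)) > u}) tends to α as u → +∞. -/
open MeasureTheory Filter Topology

/-- Conditional probability `μ(A | B) = μ(A ∩ B) / μ(B)`, with the convention that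
it equals `0` when `μ(B) = 0`. -/
noncomputable def condProb {Ω : Type*} [MeasurableSpace Ω] (μ : Measure Ω)
    (A B : Set Ω) : ℝ :=
  (μ (A ∩ B)).toReal / (μ B).toReal

/-- Invariance of the probability of cascade under strictly increasing transformations
(infinite endpoint case). -/
theorem poc_invariance_infinite_endpoint {Ω : Type*} [MeasurableSpace Ω]
    (μ : Measure Ω) [IsProbabilityMeasure μ]
    (Y : Ω → ℝ) (hY : Measurable Y)
    (A : ℝ → Set Ω) (hA : ∀ u, MeasurableSet (A u))
    (α : ℝ) (h : ℝ ≃o ℝ)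
    (hlim : Tendsto (fun u => condProb μ (A u) {ω | Y ω > u}) atTop (𝓝 α)) :
    Tendsto (fun u => condProb μ (A (h.symm u)) {ω | h (Y ω) > u}) atTop (𝓝 α) := by
  refine (hlim.comp h.symm.tendsto_atTop).congr fun u => ?_
  simp only [Function.comp_apply, gt_iff_lt, h.symm_apply_lt]
end
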